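/- Let A be a 2×2 integer matrix with determinant 1 and trace > 2, with eigenvectors v^s (for λ⁻¹) and v^u (for λ). Then for all p, z ∈ ℝ² and every w > 0, the half-strip {p + a·v^s + b·v^u : 0 ≤ a ≤ w, b ≥ 0} contains infinitely many points of the translated lattice z + ℤ². In particular, every quadrant C₊₊(x) = {x + a·v^s + b·v^u : a ≥ 0, b ≥ 0} contains infinitely many points of z + ℤ². -/

import Mathlib

/- Common setup: following the paper, we identify each subset of the torus
`𝕋² = ℝ²/ℤ²` with its (`ℤ²`-saturated) lift to `ℝ²`. -/

open Matrix Set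
open scoped Pointwise

namespace Paper

/-- Points of the plane ℝ². -/
abbrev V : Type := Fin 2 → ℝ

/-- The integer lattice ℤ² ⊆ ℝ². -/
def lattice : Set V := Set.range fun m : Fin 2 → ℤ => fun i => (m i : ℝ)

/-- The linear action of an integer matrix on ℝ². -/
def actR (A : Matrix (Fin 2) (Fin 2) ℤ) (v : V) : V :=
  (A.map (Int.cast : ℤ → ℝ)).mulVec v

/-- `E ⊆ ℝ²` is the lift of a finite subset of the torus. -/
def IsTorusFinite (E : Set V) : Prop := ∃ F : Set V, F.Finite ∧ E = F + lattice

/-- `E` is the lift of an `f_A`-invariant subset of the torus. -/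
def IsInvariant (A : Matrix (Fin 2) (Fin 2) ℤ) (E : Set V) : Prop := actR A '' E = E

/-- `E` is the lift of a periodic orbit of `f_A`. -/
def IsPeriodicOrbit (A : Matrix (Fin 2) (Fin 2) ℤ) (E : Set V) : Prop :=
  ∃ x : V, ∃ p : ℕ, 0 < p ∧ (actR A)^[p] x - x ∈ lattice ∧
    E = {v | ∃ i : ℕ, v - (actR A)^[i] x ∈ lattice}

/-- A rectangle `R(p; s, u)`, recorded via its basepoint `p` and its side
lengths `s, u > 0` (in the directions of the fixed eigenvectors `v^s, v^u`). -/
structure Rect where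
  p : V
  s : ℝ
  u : ℝ
  s_pos : 0 < s
  u_pos : 0 < u

namespace Rect

/-- The set of points of the rectangle `R(p;s,u)`. -/
def carrier (vs vu : V) (R : Rect) : Set V :=
  {q | ∃ a b : ℝ, 0 ≤ a ∧ a ≤ R.s ∧ 0 ≤ b ∧ b ≤ R.u ∧ q = R.p + a • vs + b • vu}

/-- Endpoint of the increasing diagonal (whose origin is `R.p`). -/
def incEnd (vs vu : V) (R : Rect) : V := R.p + R.s • vs + R.u • vu

/-- Origin of the decreasing diagonal. -/
def decOrigin (vs : V) (R : Rect) : V := R.p + R.s • vs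

/-- Endpoint of the decreasing diagonal. -/
def decEnd (vu : V) (R : Rect) : V := R.p + R.u • vu

/-- `R` is a positive `E`-rectangle. -/
def IsPos (vs vu : V) (E : Set V) (R : Rect) : Prop :=
  R.p ∈ E ∧ R.incEnd vs vu ∈ E

/-- `R` is a negative `E`-rectangle. -/
def IsNeg (vs vu : V) (E : Set V) (R : Rect) : Prop :=
  R.decOrigin vs ∈ E ∧ R.decEnd vu ∈ E

/-- `R` is a primitive positive `E`-rectangle. -/
def IsPrimPos (vs vu : V) (E : Set V) (R : Rect) : Prop :=
  R.IsPos vs vu E ∧ R.carrier vs vu ∩ E = {R.p, R.incEnd vs vu}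

/-- `R` is a primitive negative `E`-rectangle. -/
def IsPrimNeg (vs vu : V) (E : Set V) (R : Rect) : Prop :=
  R.IsNeg vs vu E ∧ R.carrier vs vu ∩ E = {R.decOrigin vs, R.decEnd vu}

/-- Bottom stable side of a rectangle. -/
def botSide (vs : V) (R : Rect) : Set V :=
  {q | ∃ a : ℝ, 0 ≤ a ∧ a ≤ R.s ∧ q = R.p + a • vs}

/-- Top stable side of a rectangle. -/
def topSide (vs vu : V) (R : Rect) : Set V :=
  {q | ∃ a : ℝ, 0 ≤ a ∧ a ≤ R.s ∧ q = R.p + a • vs + R.u • vu}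

/-- Left unstable side of a rectangle. -/
def leftSide (vu : V) (R : Rect) : Set V :=
  {q | ∃ b : ℝ, 0 ≤ b ∧ b ≤ R.u ∧ q = R.p + b • vu}

/-- Interior of a rectangle. -/
def interior (vs vu : V) (R : Rect) : Set V :=
  {q | ∃ a b : ℝ, 0 < a ∧ a < R.s ∧ 0 < b ∧ b < R.u ∧ q = R.p + a • vs + b • vu}

end Rect

/-- The (closed) quadrant `C₊₊(x)`. -/
def quadPP (vs vu x : V) : Set V :=
  {q | ∃ a b : ℝ, 0 ≤ a ∧ 0 ≤ b ∧ q = x + a • vs + b • vu}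

/-- `D` is a right horizontal subrectangle of `R`. -/
def IsRightHorizSub (vs : V) (D R : Rect) : Prop :=
  D.s ≤ R.s ∧ D.u = R.u ∧ D.p = R.p + (R.s - D.s) • vs

/-- A positive `X`-string with origin `x`: a sequence of positive `X`-rectangles,
the first one having `x` as origin of its increasing diagonal, consecutive ones
meeting exactly at one point which is the endpoint of the increasing diagonal of
the former and the origin of the increasing diagonal of the latter. -/
def IsPosString (vs vu : V) (X : Set V) (x : V) (R : ℕ → Rect) : Prop :=
  (∀ i, (R i).IsPos vs vu X) ∧ (R 0).p = x ∧
    ∀ i, (R i).carrier vs vu ∩ (R (i + 1)).carrier vs vu = {(R i).incEnd vs vu} ∧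
      (R (i + 1)).p = (R i).incEnd vs vu

/-- A positive `X`-staircase with origin `x`. -/
def IsPosStaircase (vs vu : V) (X : Set V) (x : V) (R : ℕ → Rect) : Prop :=
  (∀ i, (R i).carrier vs vu ⊆ quadPP vs vu x) ∧
    ∃ Del : ℕ → Rect, IsPosString vs vu X x Del ∧ R 0 = Del 0 ∧
      (∀ i, 1 ≤ i → IsRightHorizSub vs (Del i) (R i)) ∧
      (∀ i, (R i).topSide vs vu ⊆ (R (i + 1)).botSide vs) ∧
      ∃ C : ℝ, ∀ i, (Del (i + 1)).s / (Del i).s ≤ C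

/-- Stable side lengths of the primitive positive `(X, x)`-rectangles. -/
def baseLengths (vs vu : V) (X : Set V) (x : V) : Set ℝ :=
  {s | ∃ R : Rect, R.IsPrimPos vs vu X ∧ R.p = x ∧ R.s = s}

/-- The Euclidean norm of a point of ℝ². -/
noncomputable def euclNorm (v : V) : ℝ := Real.sqrt ((v 0) ^ 2 + (v 1) ^ 2)

/-- `Y` is the lift of an `ε`-dense subset of the torus, for the metric on the
torus induced by the Euclidean metric of ℝ². -/
def EDense (ε : ℝ) (Y : Set V) : Prop := ∀ v : V, ∃ y ∈ Y, euclNorm (v - y) ≤ ε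

/-- The lift of `{(0,1/2), (1/2,0), (1/2,1/2)}`, i.e. the set
`{(0,1/2), (1/2,0), (1/2,1/2)} + ℤ²`. -/
def halfPoints : Set V :=
  {v : V | ∃ w ∈ ({![0, 1/2], ![1/2, 0], ![1/2, 1/2]} : Set V), v - w ∈ lattice}

/-- The lift of the point `(1/2,1/2)` of the torus, i.e. `(1/2,1/2) + ℤ²`. -/
def halfCenter : Set V := {v : V | v - ![1/2, 1/2] ∈ lattice}

lemma actR_add (A : Matrix (Fin 2) (Fin 2) ℤ) (v w : V) :
    actR A (v + w) = actR A v + actR A w :=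
  Matrix.mulVec_add _ _ _

lemma actR_sub (A : Matrix (Fin 2) (Fin 2) ℤ) (v w : V) :
    actR A (v - w) = actR A v - actR A w :=
  Matrix.mulVec_sub _ _ _

lemma actR_smul (A : Matrix (Fin 2) (Fin 2) ℤ) (c : ℝ) (v : V) :
    actR A (c • v) = c • actR A v :=
  Matrix.mulVec_smul _ _ _

lemma actR_mem_lattice (A : Matrix (Fin 2) (Fin 2) ℤ) {v : V} (hv : v ∈ lattice) :
    actR A v ∈ lattice := by
  obtain ⟨m, rfl⟩ := hv
  refine ⟨A.mulVec m, ?_⟩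
  ext i
  simp [actR, Matrix.mulVec, dotProduct]

lemma actR_surjective {A : Matrix (Fin 2) (Fin 2) ℤ} (hdet : A.det = 1) :
    Function.Surjective (actR A) := by
  intro v
  refine ⟨actR A.adjugate v, ?_⟩
  have h : A.map (Int.cast : ℤ → ℝ) * A.adjugate.map (Int.cast : ℤ → ℝ) = 1 := by
    have := congrArg (Int.castRingHom ℝ).mapMatrix (Matrix.mul_adjugate A)
    rwa [hdet, one_smul, map_mul, map_one] at this
  rw [actR, actR, Matrix.mulVec_mulVec, h, Matrix.one_mulVec]

/-- Eigenvectors for the eigenvalues `lam⁻¹` and `lam` have nonzero wedge product. -/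
lemma wedge_ne_zero {A : Matrix (Fin 2) (Fin 2) ℤ} {lam : ℝ} (hlam : 1 < lam) {vs vu : V}
    (hvs : vs ≠ 0) (hvu : vu ≠ 0) (hAs : actR A vs = lam⁻¹ • vs)
    (hAu : actR A vu = lam • vu) : vs 0 * vu 1 - vs 1 * vu 0 ≠ 0 := by
  intro hD
  have key : ∀ i, vs i • vu = 0 := by
    intro i
    have hx : vu i • vs = vs i • vu := by
      ext j
      fin_cases i <;> fin_cases j <;> simp <;> linarith
    have h1 : lam⁻¹ • (vs i • vu) = lam • (vs i • vu) := by
      rw [smul_comm lam (vs i), ← hAu, ← actR_smul, ← hx, actR_smul, hAs, smul_comm]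
    rw [← sub_eq_zero, ← sub_smul, smul_eq_zero] at h1
    refine h1.resolve_left (sub_ne_zero.2 ?_)
    exact ((inv_lt_one_of_one_lt₀ hlam).trans hlam).ne
  apply hvs
  ext i
  exact (smul_eq_zero.1 (key i)).resolve_right hvu

/-- Every sufficiently large parallelogram meets every translate of the lattice. -/
lemma exists_parallelogram_meets_lattice {vs vu : V} (hD : vs 0 * vu 1 - vs 1 * vu 0 ≠ 0) :
    ∃ W : ℝ, ∀ p z : V, ∃ a b : ℝ, 0 ≤ a ∧ a ≤ W ∧ 0 ≤ b ∧
      p + a • vs + b • vu - z ∈ lattice := by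
  set D := vs 0 * vu 1 - vs 1 * vu 0 with hDdef
  set S := |vu 1 / D| + |vu 0 / D| with hS
  set U := |vs 1 / D| + |vs 0 / D| with hU
  have bound : ∀ s t x y : ℝ, 0 ≤ s → s < 1 → 0 ≤ t → t < 1 →
      |s * x + t * y| ≤ |x| + |y| := by
    intro s t x y hs hs1 ht ht1
    refine (abs_add_le _ _).trans (add_le_add ?_ ?_) <;> rw [abs_mul, abs_of_nonneg ‹_›]
    · exact mul_le_of_le_one_left (abs_nonneg _) hs1.le
    · exact mul_le_of_le_one_left (abs_nonneg _) ht1.le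
  refine ⟨2 * S, fun p z => ?_⟩
  set q : V := p + S • vs + U • vu - z with hq
  have hs := abs_le.1 (bound _ _ (vu 1 / D) (-(vu 0 / D)) (Int.fract_nonneg (q 0))
    (Int.fract_lt_one _) (Int.fract_nonneg (q 1)) (Int.fract_lt_one _))
  have hu := abs_le.1 (bound _ _ (-(vs 1 / D)) (vs 0 / D) (Int.fract_nonneg (q 0))
    (Int.fract_lt_one _) (Int.fract_nonneg (q 1)) (Int.fract_lt_one _))
  rw [abs_neg] at hs hu
  refine ⟨S - (Int.fract (q 0) * (vu 1 / D) + Int.fract (q 1) * -(vu 0 / D)),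
    U - (Int.fract (q 0) * -(vs 1 / D) + Int.fract (q 1) * (vs 0 / D)),
    by linarith, by linarith, by linarith, fun i => ⌊q i⌋, ?_⟩
  have h0 := Int.floor_add_fract (q 0)
  have h1 := Int.floor_add_fract (q 1)
  have e0 : q 0 = p 0 + S * vs 0 + U * vu 0 - z 0 := by simp [hq]
  have e1 : q 1 = p 1 + S * vs 1 + U * vu 1 - z 1 := by simp [hq]
  have c0 : ∀ f g : ℝ, (f * (vu 1 / D) + g * -(vu 0 / D)) * vs 0 +
      (f * -(vs 1 / D) + g * (vs 0 / D)) * vu 0 = f := by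
    intro f g
    field_simp
    rw [hDdef]
    ring
  have c1 : ∀ f g : ℝ, (f * (vu 1 / D) + g * -(vu 0 / D)) * vs 1 +
      (f * -(vs 1 / D) + g * (vs 0 / D)) * vu 1 = g := by
    intro f g
    field_simp
    rw [hDdef]
    ring
  have k0 := c0 (Int.fract (q 0)) (Int.fract (q 1))
  have k1 := c1 (Int.fract (q 0)) (Int.fract (q 1))
  ext i
  fin_cases i
  · simp only [Fin.zero_eta, Pi.sub_apply, Pi.add_apply, Pi.smul_apply, smul_eq_mul]
    linarith
  · simp only [Fin.mk_one, Pi.sub_apply, Pi.add_apply, Pi.smul_apply, smul_eq_mul]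
    linarith

/-- Every half-strip of positive width in the unstable direction meets every translate of the
lattice: a thin half-strip is the image of a wide one under a power of `A`. -/
lemma exists_halfStrip_meets_lattice {A : Matrix (Fin 2) (Fin 2) ℤ} (hdet : A.det = 1)
    {lam : ℝ} (hlam : 1 < lam) {vs vu : V} (hvs : vs ≠ 0) (hvu : vu ≠ 0)
    (hAs : actR A vs = lam⁻¹ • vs) (hAu : actR A vu = lam • vu) {w : ℝ} (hw : 0 < w)
    (p z : V) :
    ∃ a b : ℝ, 0 ≤ a ∧ a ≤ w ∧ 0 ≤ b ∧ p + a • vs + b • vu - z ∈ lattice := by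
  have hlam0 : 0 < lam := zero_lt_one.trans hlam
  obtain ⟨W, hW⟩ := exists_parallelogram_meets_lattice (wedge_ne_zero hlam hvs hvu hAs hAu)
  have contract : ∀ n : ℕ, ∀ p z : V, ∃ a b : ℝ, 0 ≤ a ∧ a ≤ W / lam ^ n ∧ 0 ≤ b ∧
      p + a • vs + b • vu - z ∈ lattice := by
    intro n
    induction n with
    | zero => simpa using hW
    | succ n ih =>
      intro p z
      obtain ⟨p, rfl⟩ := actR_surjective hdet p
      obtain ⟨z, rfl⟩ := actR_surjective hdet z
      obtain ⟨a, b, ha, haW, hb, hm⟩ := ih p z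
      refine ⟨a * lam⁻¹, b * lam, by positivity, ?_, by positivity, ?_⟩
      · rw [pow_succ, ← div_div, ← div_eq_mul_inv]
        gcongr
      · simpa [actR_sub, actR_add, actR_smul, hAs, hAu, smul_smul]
          using actR_mem_lattice A hm
  obtain ⟨n, hn⟩ := pow_unbounded_of_one_lt (W / w) hlam
  obtain ⟨a, b, ha, haW, hb, hm⟩ := contract n p z
  refine ⟨a, b, ha, haW.trans ?_, hb, hm⟩
  rw [div_le_iff₀ (by positivity), mul_comm]
  exact (div_le_iff₀ hw).1 hn.le

/-- every half-strip `{p + a·v^s + b·v^u : 0 ≤ a ≤ w, b ≥ 0}`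
contains infinitely many points of any translated lattice `z + ℤ²`; in
particular every quadrant `C₊₊(x)` does. -/
theorem statement_11 (A : Matrix (Fin 2) (Fin 2) ℤ) (hdet : A.det = 1) (htr : 2 < A.trace)
    (lam : ℝ) (hlam : 1 < lam) (vs vu : V) (hvs : vs ≠ 0) (hvu : vu ≠ 0)
    (hAs : actR A vs = lam⁻¹ • vs) (hAu : actR A vu = lam • vu) :
    (∀ p z : V, ∀ w : ℝ, 0 < w →
      ({q : V | ∃ a b : ℝ, 0 ≤ a ∧ a ≤ w ∧ 0 ≤ b ∧ q = p + a • vs + b • vu} ∩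
        {v : V | v - z ∈ lattice}).Infinite) ∧
    ∀ z x : V, (quadPP vs vu x ∩ {v : V | v - z ∈ lattice}).Infinite := by
  have strip : ∀ p z : V, ∀ w : ℝ, 0 < w →
      ({q : V | ∃ a b : ℝ, 0 ≤ a ∧ a ≤ w ∧ 0 ≤ b ∧ q = p + a • vs + b • vu} ∩
        {v : V | v - z ∈ lattice}).Infinite := by
    intro p z w hw
    have hD := wedge_ne_zero hlam hvs hvu hAs hAu
    -- the `vu`-coordinate relative to `p`, which is unbounded on the set
    let f : V → ℝ := fun q =>
      (vs 0 * (q 1 - p 1) - vs 1 * (q 0 - p 0)) / (vs 0 * vu 1 - vs 1 * vu 0)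
    have hf : ∀ a b : ℝ, f (p + a • vs + b • vu) = b := by
      intro a b
      simp only [f, Pi.add_apply, Pi.smul_apply, smul_eq_mul]
      rw [div_eq_iff hD]
      ring
    refine Set.Infinite.of_image f (Set.infinite_of_not_bddAbove ?_)
    rintro ⟨B, hB⟩
    obtain ⟨a, b, ha, haw, hb, hm⟩ := exists_halfStrip_meets_lattice hdet hlam hvs hvu hAs hAu
      hw (p + (|B| + 1) • vu) z
    have hq : p + (|B| + 1) • vu + a • vs + b • vu = p + a • vs + (|B| + 1 + b) • vu := by
      module
    rw [hq] at hm
    have hle := hB ⟨_, ⟨⟨a, |B| + 1 + b, ha, haw, by positivity, rfl⟩, hm⟩, hf _ _⟩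
    linarith [le_abs_self B]
  refine ⟨strip, fun z x => (strip x z 1 one_pos).mono ?_⟩
  rintro q ⟨⟨a, b, ha, -, hb, rfl⟩, hq⟩
  exact ⟨⟨a, b, ha, hb, rfl⟩, hq⟩

end Paper
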